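/- Let D ⊆ ℂⁿ be a bounded strictly convex domain, let λ₁,…,λ_m ∈ 𝔻 be pairwise distinct, and let f, g : 𝔻 → D be holomorphic maps which are both weak m-extremals for λ₁,…,λ_m and satisfy f(λ_j) = g(λ_j) for j = 1,…,m. Then f = g. -/

import Mathlib

open Complex Metric Set Filter

noncomputable section

/-- The open unit disc `𝔻` in `ℂ`. -/
def unitDisc : Set ℂ := Metric.ball (0 : ℂ) 1

/-- The Möbius function `m_α(λ) = (λ - α)/(1 - conj α · λ)`. -/
def mobius (a z : ℂ) : ℂ := (z - a) / (1 - (starRingEnd ℂ) a * z)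

/-- `B` agrees on the unit disc with a finite Blaschke product
`ζ · ∏_{j=1}^k m_{α_j}` of degree `k` (here `ζ ∈ 𝕋`, `α_j ∈ 𝔻`). -/
def IsBlaschkeOn (B : ℂ → ℂ) (k : ℕ) : Prop :=
  ∃ (ζ : ℂ) (α : Fin k → ℂ), ‖ζ‖ = 1 ∧ (∀ j, ‖α j‖ < 1) ∧
    ∀ z ∈ unitDisc, B z = ζ * ∏ j, mobius (α j) z

variable {E : Type*} [NormedAddCommGroup E] [NormedSpace ℂ E]

/-- `f` is a weak `m`-extremal for the nodes `lam` with respect to the domain `D`: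
there is no map `h`, holomorphic on an open neighborhood of the closed unit disc
with values in `D`, interpolating `f` at all the nodes. -/
def WeakExtremalFor (D : Set E) (f : ℂ → E) {m : ℕ} (lam : Fin m → ℂ) : Prop :=
  ¬ ∃ (U : Set ℂ) (h : ℂ → E), IsOpen U ∧ Metric.closedBall (0 : ℂ) 1 ⊆ U ∧
      DifferentiableOn ℂ h U ∧ Set.MapsTo h U D ∧ ∀ j, h (lam j) = f (lam j)

/-- `f` is a weak `m`-extremal of `D`: it is a weak `m`-extremal for some
pairwise distinct nodes in the unit disc. -/
def IsWeakExtremal (D : Set E) (f : ℂ → E) (m : ℕ) : Prop :=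
  ∃ lam : Fin m → ℂ, Function.Injective lam ∧ (∀ j, lam j ∈ unitDisc) ∧
    WeakExtremalFor D f lam

/-- `f` is an `m`-extremal of `D`: it is a weak `m`-extremal for every choice of
pairwise distinct nodes in the unit disc. -/
def IsExtremal (D : Set E) (f : ℂ → E) (m : ℕ) : Prop :=
  ∀ lam : Fin m → ℂ, Function.Injective lam → (∀ j, lam j ∈ unitDisc) →
    WeakExtremalFor D f lam

/-- `f` is an `m`-geodesic of `D`: there is a holomorphic `F : D → 𝔻` such that
`F ∘ f` is a non-constant Blaschke product of degree at most `m - 1`. -/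
def IsGeodesic (D : Set E) (f : ℂ → E) (m : ℕ) : Prop :=
  ∃ F : E → ℂ, DifferentiableOn ℂ F D ∧ Set.MapsTo F D unitDisc ∧
    ∃ k : ℕ, 1 ≤ k ∧ k ≤ m - 1 ∧ IsBlaschkeOn (fun z => F (f z)) k

/-- A domain `D ⊆ ℂⁿ` is `k`-balanced (quasi-balanced) if
`(λ^{k₁} z₁, …, λ^{k_n} z_n) ∈ D` for all `λ` in the closed unit disc, `z ∈ D`. -/
def QuasiBalanced {n : ℕ} (k : Fin n → ℕ) (D : Set (Fin n → ℂ)) : Prop :=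
  ∀ l : ℂ, ‖l‖ ≤ 1 → ∀ z ∈ D, (fun j => l ^ k j * z j) ∈ D

/-- The complex ellipsoid `E(p) = {z ∈ ℂⁿ : Σ_j |z_j|^{2 p_j} < 1}`. -/
def ellipsoid {n : ℕ} (p : Fin n → ℝ) : Set (Fin n → ℂ) :=
  {z | ∑ j, ‖z j‖ ^ (2 * p j) < 1}

/-- The Euclidean unit ball `𝔹_n ⊆ ℂⁿ`. -/
def euclideanBall (n : ℕ) : Set (Fin n → ℂ) :=
  {z | ∑ j, ‖z j‖ ^ 2 < 1}


open scoped Topology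

lemma isPreconnected_unitDisc : IsPreconnected unitDisc :=
  (convex_ball (0 : ℂ) 1).isPreconnected

lemma isOpen_unitDisc : IsOpen unitDisc := Metric.isOpen_ball

/-- Dividing out the zero of a holomorphic function at a single point. -/
lemma exists_eq_pow_mul_of_mem_unitDisc {φ : ℂ → ℂ} (hφ : DifferentiableOn ℂ φ unitDisc)
    (hne : ∃ z ∈ unitDisc, φ z ≠ 0) {a : ℂ} (ha : a ∈ unitDisc) :
    ∃ (k : ℕ) (w : ℂ → ℂ), DifferentiableOn ℂ w unitDisc ∧ w a ≠ 0 ∧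
      ∀ z ∈ unitDisc, φ z = (z - a) ^ k * w z := by
  have hana : AnalyticOnNhd ℂ φ unitDisc := hφ.analyticOnNhd isOpen_unitDisc
  have hnz : ¬ ∀ᶠ z in 𝓝 a, φ z = 0 := by
    intro h
    obtain ⟨z, hz, hz0⟩ := hne
    exact hz0 (hana.eqOn_zero_of_preconnected_of_eventuallyEq_zero
      isPreconnected_unitDisc ha h hz)
  obtain ⟨k, v, hv, hva, hev⟩ := (hana a ha).exists_eventuallyEq_pow_smul_nonzero_iff.mpr hnz
  refine ⟨k, Function.update (fun z => φ z / (z - a) ^ k) a (v a), ?_, by simpa, ?_⟩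
  · intro z hz
    refine DifferentiableAt.differentiableWithinAt ?_
    by_cases hza : z = a
    · subst hza
      refine hv.differentiableAt.congr_of_eventuallyEq ?_
      filter_upwards [hev] with y hy
      by_cases hyz : y = z
      · simp [hyz]
      · rw [Function.update_of_ne hyz, hy, smul_eq_mul,
          mul_div_cancel_left₀ _ (pow_ne_zero _ (sub_ne_zero.2 hyz))]
    · have h1 : DifferentiableAt ℂ (fun z => φ z / (z - a) ^ k) z :=
        (hφ.differentiableAt (isOpen_unitDisc.mem_nhds hz)).div (by fun_prop)
          (pow_ne_zero _ (sub_ne_zero.2 hza))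
      refine h1.congr_of_eventuallyEq ?_
      filter_upwards [isOpen_ne.mem_nhds hza] with y hy
      rw [Function.update_of_ne hy]
  · intro z hz
    by_cases hza : z = a
    · subst hza
      simpa using hev.self_of_nhds
    · rw [Function.update_of_ne hza, mul_div_cancel₀ _ (pow_ne_zero _ (sub_ne_zero.2 hza))]

/-- Dividing out the zeros of a holomorphic function at finitely many points. -/
lemma exists_eq_mul_ne_zero_on_finset {φ : ℂ → ℂ} (hφ : DifferentiableOn ℂ φ unitDisc)
    (hne : ∃ z ∈ unitDisc, φ z ≠ 0) (S : Finset ℂ) (hS : ∀ a ∈ S, a ∈ unitDisc) :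
    ∃ P w : ℂ → ℂ, Continuous P ∧ (∀ z ∉ S, P z ≠ 0) ∧ DifferentiableOn ℂ w unitDisc ∧
      (∀ a ∈ S, w a ≠ 0) ∧ ∀ z ∈ unitDisc, φ z = P z * w z := by
  classical
  induction S using Finset.induction_on with
  | empty => exact ⟨fun _ => 1, φ, continuous_const, by simp, hφ, by simp, by simp⟩
  | insert a S _ ih =>
    obtain ⟨P, w, hP, hP0, hw, hwS, h⟩ := ih fun b hb => hS b (Finset.mem_insert_of_mem hb)
    obtain ⟨z, hz, hz0⟩ := hne
    obtain ⟨k, v, hv, hva, hvw⟩ := exists_eq_pow_mul_of_mem_unitDisc hw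
      ⟨z, hz, fun h0 => hz0 (by rw [h z hz, h0, mul_zero])⟩ (hS a (Finset.mem_insert_self a S))
    refine ⟨fun z => P z * (z - a) ^ k, v, by fun_prop, fun y hy => ?_, hv, fun b hb => ?_,
      fun y hy => by rw [h y hy, hvw y hy, mul_assoc]⟩
    · rw [Finset.mem_insert, not_or] at hy
      exact mul_ne_zero (hP0 y hy.2) (pow_ne_zero _ (sub_ne_zero.2 hy.1))
    · rcases Finset.mem_insert.1 hb with rfl | hb'
      · exact hva
      · intro h0
        exact hwS b hb' (by rw [hvw b (hS b hb), h0, mul_zero])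

/-- Lagrange interpolation at distinct nodes with vector values. -/
lemma exists_lagrange {m : ℕ} {lam : Fin m → ℂ} (hinj : Function.Injective lam) :
    ∃ ℓ : Fin m → ℂ → ℂ, (∀ i, Differentiable ℂ (ℓ i)) ∧
      ∀ (F : Type) [NormedAddCommGroup F] [NormedSpace ℂ F] (v : Fin m → F) (j : Fin m),
        ∑ i, ℓ i (lam j) • v i = v j := by
  refine ⟨fun i z => (Lagrange.basis Finset.univ lam i).eval z,
    fun i => Polynomial.differentiable _, fun F _ _ v j => ?_⟩
  simp only
  rw [Finset.sum_eq_single j]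
  · rw [Lagrange.eval_basis_self hinj.injOn (Finset.mem_univ j), one_smul]
  · intro i _ hij
    rw [Lagrange.eval_basis_of_ne hij (Finset.mem_univ j), zero_smul]
  · simp

/-- Maximum principle: a holomorphic map on the disc whose values near the circle lie in a closed
convex set has all its values there. -/
lemma mapsTo_of_mapsTo_annulus {F : Type*} [NormedAddCommGroup F] [NormedSpace ℝ F]
    [NormedSpace ℂ F] [IsScalarTower ℝ ℂ F]
    {K : Set F} (hK : Convex ℝ K) (hKc : IsClosed K) {H : ℂ → F}
    (hH : DifferentiableOn ℂ H unitDisc) {r₀ : ℝ} (hr₀ : r₀ < 1)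
    (hA : ∀ z ∈ unitDisc, r₀ ≤ ‖z‖ → H z ∈ K) : MapsTo H unitDisc K := by
  intro z hz
  by_contra hzK
  obtain ⟨l, u, hlu, hul⟩ := RCLike.geometric_hahn_banach_closed_point (𝕜 := ℂ) hK hKc hzK
  have hz1 : ‖z‖ < 1 := by simpa [unitDisc] using hz
  obtain ⟨r, hr, hr1⟩ := exists_between (max_lt (max_lt hr₀ hz1) zero_lt_one)
  have hr0 : 0 < r := lt_of_le_of_lt (le_max_right _ _) hr
  have hzr : ‖z‖ < r := lt_of_le_of_lt ((le_max_right _ _).trans (le_max_left _ _)) hr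
  have hr₀r : r₀ ≤ r := (((le_max_left _ _).trans (le_max_left _ _)).trans_lt hr).le
  have hsub : closedBall (0 : ℂ) r ⊆ unitDisc := closedBall_subset_ball hr1
  have hd : DifferentiableOn ℂ (fun y => Complex.exp (l (H y))) unitDisc :=
    (l.differentiable.comp_differentiableOn hH).cexp
  have hmax := Complex.norm_le_of_forall_mem_frontier_norm_le (U := ball (0 : ℂ) r)
    (f := fun y => Complex.exp (l (H y))) isBounded_ball
    (hd.diffContOnCl_ball hsub) (C := Real.exp u) (fun y hy => ?_)
    (subset_closure (by simpa using hzr : z ∈ ball (0 : ℂ) r))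
  · rw [Complex.norm_exp, Real.exp_le_exp] at hmax
    exact absurd hmax (not_le.2 hul)
  · rw [frontier_ball _ hr0.ne', mem_sphere_zero_iff_norm] at hy
    rw [Complex.norm_exp, Real.exp_le_exp]
    exact (hlu _ (hA y (hsub (by simp [hy])) (by rw [hy]; exact hr₀r))).le

/-- A map of the disc with relatively compact image in `D` is not a weak extremal. -/
lemma not_weakExtremalFor_of_mapsTo_compact {F : Type} [NormedAddCommGroup F] [NormedSpace ℂ F]
    {D K : Set F} (hD : IsOpen D) (hK : IsCompact K) (hKD : K ⊆ D) {H : ℂ → F}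
    (hH : DifferentiableOn ℂ H unitDisc) (hHK : MapsTo H unitDisc K)
    {m : ℕ} {lam : Fin m → ℂ} (hinj : Function.Injective lam) (hmem : ∀ j, lam j ∈ unitDisc) :
    ¬ WeakExtremalFor D H lam := by
  unfold WeakExtremalFor
  rw [not_not]
  obtain ⟨ℓ, hℓ, hℓv⟩ := exists_lagrange hinj
  obtain ⟨δ, hδ, hδD⟩ := hK.exists_thickening_subset_open hD hKD
  have hcont : Continuous fun z => ∑ i, ‖ℓ i z‖ :=
    continuous_finsetSum _ fun i _ => (hℓ i).continuous.norm
  obtain ⟨C, hC⟩ := (isCompact_closedBall (0 : ℂ) 2).exists_bound_of_continuousOn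
    hcont.continuousOn
  have hC' : ∀ z ∈ closedBall (0 : ℂ) 2, ∑ i, ‖ℓ i z‖ ≤ max C 0 := fun z hz =>
    (le_abs_self _).trans ((hC z hz).trans (le_max_left _ _))
  have hη : 0 < δ / (max C 0 + 1) := div_pos hδ (by positivity)
  have hlim : ∀ᶠ r : ℝ in 𝓝 1, ∀ j, ‖H (lam j) - H (r * lam j)‖ < δ / (max C 0 + 1) := by
    rw [eventually_all]
    intro j
    have h1 : ContinuousAt (fun r : ℝ => H (r * lam j)) 1 := by
      refine ContinuousAt.comp (g := H) ?_ (by fun_prop)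
      simpa using (hH.differentiableAt (isOpen_unitDisc.mem_nhds (hmem j))).continuousAt
    have h2 : ContinuousAt (fun r : ℝ => ‖H (lam j) - H (r * lam j)‖) 1 :=
      (continuousAt_const.sub h1).norm
    exact h2.eventually_lt continuousAt_const (by simpa using hη)
  obtain ⟨r, hr, hr2, hr1⟩ := ((hlim.filter_mono nhdsWithin_le_nhds).and
    (Ioo_mem_nhdsLT (by norm_num : (1 / 2 : ℝ) < 1))).exists
  have hr0 : 0 < r := by linarith
  have hmaps : MapsTo (fun z : ℂ => r * z) (ball 0 (1 / r)) unitDisc := by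
    intro z hz
    rw [mem_ball_zero_iff, lt_div_iff₀ hr0] at hz
    simpa [unitDisc, abs_of_pos hr0, mul_comm] using hz
  refine ⟨ball 0 (1 / r), fun z => H (r * z) + ∑ i, ℓ i z • (H (lam i) - H (r * lam i)),
    isOpen_ball, closedBall_subset_ball (by rw [lt_div_iff₀ hr0]; linarith), ?_, ?_, ?_⟩
  · refine (hH.comp (by fun_prop) hmaps).add (Differentiable.differentiableOn ?_)
    exact Differentiable.fun_sum fun i _ => (hℓ i).smul_const _
  · intro z hz
    apply hδD
    rw [mem_thickening_iff]
    refine ⟨H (r * z), hHK (hmaps hz), ?_⟩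
    rw [dist_eq_norm, add_sub_cancel_left]
    have hz2 : z ∈ closedBall (0 : ℂ) 2 := by
      refine ball_subset_closedBall (ball_subset_ball ?_ hz)
      rw [div_le_iff₀ hr0]; linarith
    calc ‖∑ i, ℓ i z • (H (lam i) - H (r * lam i))‖
        ≤ ∑ i, ‖ℓ i z‖ * (δ / (max C 0 + 1)) := by
          refine norm_sum_le_of_le _ fun i _ => ?_
          rw [norm_smul]
          gcongr
          exact (hr i).le
      _ = (∑ i, ‖ℓ i z‖) * (δ / (max C 0 + 1)) := by rw [Finset.sum_mul]
      _ ≤ max C 0 * (δ / (max C 0 + 1)) := by gcongr; exact hC' z hz2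
      _ < (max C 0 + 1) * (δ / (max C 0 + 1)) := by gcongr; linarith
      _ = δ := mul_div_cancel₀ _ (by positivity)
  · intro j
    simp only [hℓv]
    abel

/-- A holomorphic function equal to `1` at the nodes, bounded near the circle, and arbitrarily small
where a given bounded holomorphic function `φ ≢ 0` is small. -/
lemma exists_eq_one_at_nodes_small_where_small {φ : ℂ → ℂ} (hφ : DifferentiableOn ℂ φ unitDisc)
    (hne : ∃ z ∈ unitDisc, φ z ≠ 0) {M : ℝ} (hM : ∀ z ∈ unitDisc, ‖φ z‖ ≤ M)
    {m : ℕ} {lam : Fin m → ℂ} (hinj : Function.Injective lam) (hmem : ∀ j, lam j ∈ unitDisc)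
    {κ : ℝ} (hκ : 0 < κ) :
    ∃ (r₀ C ε : ℝ) (e : ℂ → ℂ), r₀ < 1 ∧ 0 < ε ∧ DifferentiableOn ℂ e unitDisc ∧
      (∀ j, e (lam j) = 1) ∧ ∀ z ∈ unitDisc, r₀ ≤ ‖z‖ →
        ‖e z‖ ≤ C ∧ (‖φ z‖ < ε → ‖e z‖ ≤ κ) := by
  classical
  obtain ⟨ℓ, hℓ, hℓv⟩ := exists_lagrange hinj
  obtain ⟨P, w, hP, hP0, hw, hw0, hPw⟩ := exists_eq_mul_ne_zero_on_finset hφ hne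
    (Finset.univ.image lam) (by simpa using hmem)
  obtain ⟨r₀, hr₀, hr₀1⟩ : ∃ r₀ : ℝ, (∀ j, ‖lam j‖ < r₀) ∧ r₀ < 1 := by
    refine Filter.Eventually.exists (f := 𝓝[<] (1 : ℝ)) ((eventually_all.2 fun j => ?_).and
      self_mem_nhdsWithin)
    exact nhdsWithin_le_nhds (Ioi_mem_nhds (by simpa [unitDisc] using hmem j))
  obtain ⟨σ, hσ, hσ0⟩ : ∃ σ : ℝ, (∀ j, 2 * σ < ‖w (lam j)‖) ∧ 0 < σ := by
    refine Filter.Eventually.exists (f := 𝓝[>] (0 : ℝ)) ((eventually_all.2 fun j => ?_).and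
      self_mem_nhdsWithin)
    have hj : 0 < ‖w (lam j)‖ / 2 := half_pos (norm_pos_iff.2 (hw0 _ (by simp)))
    filter_upwards [nhdsWithin_le_nhds (Iio_mem_nhds hj)] with σ hσ
    rw [mem_Iio] at hσ
    linarith
  have hcont : Continuous fun z => ∑ i, ‖ℓ i z‖ :=
    continuous_finsetSum _ fun i _ => (hℓ i).continuous.norm
  obtain ⟨L, hL⟩ := (isCompact_closedBall (0 : ℂ) 1).exists_bound_of_continuousOn
    hcont.continuousOn
  have hA : IsCompact (closedBall (0 : ℂ) 1 ∩ {z | r₀ ≤ ‖z‖}) :=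
    (isCompact_closedBall _ _).inter_right (isClosed_le continuous_const continuous_norm)
  obtain ⟨d, hd, hPd⟩ := hA.exists_forall_le' (a := 0) (f := fun z => ‖P z‖)
    hP.norm.continuousOn fun z hz => norm_pos_iff.2 <| hP0 z fun hzS => by
      obtain ⟨j, -, rfl⟩ := Finset.mem_image.1 hzS
      exact absurd hz.2 (not_le.2 (hr₀ j))
  obtain ⟨N, hN⟩ : ∃ N : ℕ, L * (1 / 2 : ℝ) ^ N ≤ κ := by
    have h : Tendsto (fun N : ℕ => L * (1 / 2 : ℝ) ^ N) atTop (𝓝 (L * 0)) :=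
      (tendsto_pow_atTop_nhds_zero_of_lt_one (by norm_num) (by norm_num)).const_mul L
    rw [mul_zero] at h
    exact ((h.eventually_lt_const hκ).exists).imp fun _ h => h.le
  have hbound : ∀ z ∈ unitDisc, ‖∑ i, ℓ i z • (w z ^ N / w (lam i) ^ N)‖ ≤
      L * (‖w z‖ / (2 * σ)) ^ N := by
    intro z hz
    calc ‖∑ i, ℓ i z • (w z ^ N / w (lam i) ^ N)‖
        ≤ ∑ i, ‖ℓ i z‖ * (‖w z‖ / (2 * σ)) ^ N := by
          refine norm_sum_le_of_le _ fun i _ => ?_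
          rw [norm_smul, ← div_pow, norm_pow, norm_div]
          gcongr
          exact (hσ i).le
      _ = (∑ i, ‖ℓ i z‖) * (‖w z‖ / (2 * σ)) ^ N := by rw [Finset.sum_mul]
      _ ≤ _ := by
          gcongr
          exact (le_abs_self _).trans (hL z (ball_subset_closedBall hz))
  have hL0 : 0 ≤ L := (norm_nonneg _).trans (hL 0 (by simp))
  refine ⟨r₀, L * (M / d / (2 * σ)) ^ N, d * σ, fun z => ∑ i, ℓ i z • (w z ^ N / w (lam i) ^ N),
    hr₀1, by positivity, ?_, fun j => ?_, fun z hz hzr => ?_⟩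
  · exact DifferentiableOn.fun_sum fun i _ =>
      (hℓ i).differentiableOn.smul ((hw.pow N).div_const _)
  · simp only
    rw [hℓv ℂ (fun i => w (lam j) ^ N / w (lam i) ^ N) j,
      div_self (pow_ne_zero _ (hw0 _ (by simp)))]
  · have hdP : d * ‖w z‖ ≤ ‖φ z‖ := by
      rw [hPw z hz, norm_mul]
      gcongr
      exact hPd z ⟨ball_subset_closedBall hz, hzr⟩
    refine ⟨(hbound z hz).trans ?_, fun hlt => (hbound z hz).trans (le_trans ?_ hN)⟩
    · gcongr
      rw [le_div_iff₀ hd]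
      linarith [hM z hz]
    · have hwσ : ‖w z‖ < σ := lt_of_mul_lt_mul_left (hdP.trans_lt hlt) hd.le
      gcongr ?_ * ?_ ^ N
      rw [div_le_div_iff₀ (by positivity) (by norm_num)]
      linarith

/-- In a bounded strictly convex domain `D ⊆ ℂⁿ`, two weak
`m`-extremals for the same pairwise distinct nodes `λ₁, …, λ_m` that agree at
those nodes coincide. -/
theorem weak_extremals_unique_in_strictly_convex
    {n : ℕ} (D : Set (Fin n → ℂ)) (hDo : IsOpen D) (hDc : IsConnected D)
    (hbdd : Bornology.IsBounded D)
    (hsc : ∀ a ∈ closure D, ∀ b ∈ closure D, a ≠ b →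
      ∀ t : ℝ, 0 < t → t < 1 → t • a + (1 - t) • b ∈ D)
    (m : ℕ) (hm : 2 ≤ m)
    (lam : Fin m → ℂ) (hinj : Function.Injective lam)
    (hmem : ∀ j, lam j ∈ unitDisc)
    (f g : ℂ → Fin n → ℂ)
    (hf : DifferentiableOn ℂ f unitDisc) (hfD : Set.MapsTo f unitDisc D)
    (hg : DifferentiableOn ℂ g unitDisc) (hgD : Set.MapsTo g unitDisc D)
    (hfw : WeakExtremalFor D f lam) (hgw : WeakExtremalFor D g lam)
    (heq : ∀ j, f (lam j) = g (lam j)) :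
    Set.EqOn f g unitDisc := by
  by_contra hfg
  obtain ⟨z₀, hz₀, hfg₀⟩ : ∃ z ∈ unitDisc, f z ≠ g z := by simpa [Set.EqOn] using hfg
  obtain ⟨k, hk⟩ := Function.ne_iff.1 hfg₀
  obtain ⟨x₀, hx₀⟩ := hDc.nonempty
  have hcl : IsCompact (closure D) := hbdd.isCompact_closure
  have hconv : Convex ℝ D := by
    rw [convex_iff_forall_pos]
    intro a ha b hb s t hs ht hst
    by_cases hab : a = b
    · rwa [hab, ← add_smul, hst, one_smul, ← hab]
    · simpa [← hst] using hsc a (subset_closure ha) b (subset_closure hb) hab s hs (by linarith)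
  obtain ⟨ρ, hρ, hρD⟩ := Metric.isOpen_iff.1 hDo x₀ hx₀
  obtain ⟨M, hM⟩ := hbdd.exists_norm_le
  have hM0 : 0 ≤ M := (norm_nonneg _).trans (hM x₀ hx₀)
  have hdiff : ∀ a ∈ D, ∀ b ∈ D, ‖a - b‖ ≤ 2 * M + 1 := fun a ha b hb => by
    linarith [norm_sub_le a b, hM a ha, hM b hb]
  have hκ : 0 < ρ / 2 / (2 * M + 1) := by positivity
  obtain ⟨r₀, C, ε, e, hr₀, hε, he, hej, heC⟩ :=
    exists_eq_one_at_nodes_small_where_small (φ := fun z => f z k - g z k) (M := 2 * M + 1)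
      ((differentiableOn_pi.1 hf k).sub (differentiableOn_pi.1 hg k))
      ⟨z₀, hz₀, sub_ne_zero.2 hk⟩
      (fun z hz => (norm_le_pi_norm (f z - g z) k).trans (hdiff _ (hfD hz) _ (hgD hz)))
      hinj hmem hκ
  -- midpoints of pairs of points of `closure D` at distance at least `ε`
  let T : Set ((Fin n → ℂ) × (Fin n → ℂ)) := (closure D ×ˢ closure D) ∩ {p | ε ≤ ‖p.1 - p.2‖}
  let mid : (Fin n → ℂ) × (Fin n → ℂ) → Fin n → ℂ :=
    fun p => (1 / 2 : ℝ) • p.1 + (1 - 1 / 2 : ℝ) • p.2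
  have hT : IsCompact (mid '' T) := by
    refine ((hcl.prod hcl).inter_right (isClosed_le (by fun_prop) (by fun_prop))).image ?_
    fun_prop
  have hTD : mid '' T ⊆ D := by
    rintro _ ⟨⟨a, b⟩, ⟨⟨ha, hb⟩, hab⟩, rfl⟩
    refine hsc a ha b hb ?_ _ (by norm_num) (by norm_num)
    rintro rfl
    simp only [mem_ofPred_eq, sub_self, norm_zero] at hab
    linarith
  obtain ⟨δ, hδ, hδD⟩ := hT.exists_thickening_subset_open hDo hTD
  obtain ⟨c, hcδ, hc1, hc0⟩ : ∃ c : ℝ, c / (1 - c) * (C * (2 * M + 1)) < δ ∧ c < 1 ∧ 0 < c := by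
    have h : ContinuousAt (fun c : ℝ => c / (1 - c) * (C * (2 * M + 1))) 0 := by
      refine ContinuousAt.mul (continuousAt_id.div (by fun_prop) (by norm_num)) continuousAt_const
    have h' := h.eventually_lt continuousAt_const (by simpa using hδ)
    exact (((h'.and (Iio_mem_nhds one_pos)).filter_mono nhdsWithin_le_nhds).and
      (self_mem_nhdsWithin (a := (0 : ℝ)) (s := Ioi (0 : ℝ)))).exists.imp fun c hc => ⟨hc.1.1, hc.1.2, hc.2⟩
  let K : Set (Fin n → ℂ) := (fun p : (Fin n → ℂ) × (Fin n → ℂ) => (1 - c) • p.1 + c • p.2) ''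
    (closure D ×ˢ closedBall x₀ (ρ / 2))
  have hρD' : closedBall x₀ (ρ / 2) ⊆ D := (closedBall_subset_ball (by linarith)).trans hρD
  have hK : IsCompact K := (hcl.prod (isCompact_closedBall _ _)).image (by fun_prop)
  have hKconv : Convex ℝ K := by
    refine (hconv.closure.prod (convex_closedBall _ _)).is_linear_image ?_
    exact ⟨fun p q => by simp only [Prod.fst_add, Prod.snd_add, smul_add]; abel,
      fun t p => by simp only [Prod.smul_fst, Prod.smul_snd, smul_add, smul_comm t]⟩
  have hKD : K ⊆ D := by
    rintro _ ⟨⟨a, b⟩, ⟨ha, hb⟩, rfl⟩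
    by_cases hab : a = b
    · simp only [hab, ← add_smul, sub_add_cancel, one_smul]
      exact hρD' hb
    · simpa using hsc a ha b (subset_closure (hρD' hb)) hab (1 - c) (by linarith) (by linarith)
  let h : ℂ → Fin n → ℂ := fun z => mid (f z, g z)
  have hhD : ∀ z ∈ unitDisc, h z ∈ D := fun z hz =>
    hconv (hfD hz) (hgD hz) (by norm_num) (by norm_num) (by norm_num)
  have hh : DifferentiableOn ℂ h unitDisc := (hf.const_smul (1 / 2 : ℝ)).add (hg.const_smul (1 - 1 / 2 : ℝ))
  let H : ℂ → Fin n → ℂ := fun z => (1 - c) • h z + c • (x₀ + e z • (h z - x₀))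
  have hH : DifferentiableOn ℂ H unitDisc :=
    (hh.const_smul (1 - c)).add (((he.smul (hh.sub_const x₀)).const_add x₀).const_smul c)
  have hHK : MapsTo H unitDisc K := by
    refine mapsTo_of_mapsTo_annulus hKconv hK.isClosed hH hr₀ fun z hz hzr => ?_
    obtain ⟨h1, h2⟩ := heC z hz hzr
    have hhx := hdiff _ (hhD z hz) _ hx₀
    by_cases hs : ‖f z k - g z k‖ < ε
    · refine ⟨(h z, x₀ + e z • (h z - x₀)), ⟨subset_closure (hhD z hz), ?_⟩, rfl⟩
      rw [mem_closedBall, dist_eq_norm, add_sub_cancel_left, norm_smul]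
      calc ‖e z‖ * ‖h z - x₀‖ ≤ ρ / 2 / (2 * M + 1) * (2 * M + 1) := by gcongr; exact h2 hs
        _ = ρ / 2 := div_mul_cancel₀ _ (by positivity)
    · have hc1' : 0 < 1 - c := by linarith
      refine ⟨(h z + (c / (1 - c)) • e z • (h z - x₀), x₀),
        ⟨subset_closure (hδD ?_), mem_closedBall_self (by positivity)⟩, ?_⟩
      · rw [mem_thickening_iff]
        refine ⟨h z, ⟨(f z, g z), ⟨⟨subset_closure (hfD hz), subset_closure (hgD hz)⟩, ?_⟩, rfl⟩, ?_⟩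
        · exact (not_lt.1 hs).trans (norm_le_pi_norm (f z - g z) k)
        · rw [dist_eq_norm, add_sub_cancel_left, norm_smul, norm_smul, Real.norm_of_nonneg
            (by positivity)]
          refine lt_of_le_of_lt ?_ hcδ
          have : 0 ≤ C := (norm_nonneg _).trans h1
          gcongr
      · simp only [H, smul_add, smul_smul, mul_div_cancel₀ _ hc1'.ne']
        abel
  have hHlam : ∀ j, H (lam j) = f (lam j) := by
    intro j
    simp only [H, h, mid, hej, ← heq, one_smul, add_sub_cancel, ← add_smul, sub_add_cancel]
  refine not_weakExtremalFor_of_mapsTo_compact hDo hK hKD hH hHK hinj hmem ?_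
  simpa only [WeakExtremalFor, hHlam] using hfw
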